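/- Let ‖·‖ be a norm on ℝ^d, V_d the Lebesgue measure of its unit ball, and r > 0. For any Borel set B ⊆ ℝ^d of finite Lebesgue measure Λ and any x̂ ∈ ℝ^d: ∫_B ‖x − x̂‖^r dx ≥ (d/(d+r)) · Λ^{1+r/d} / V_d^{r/d}. Equivalently, among Borel sets of a given Lebesgue measure, the ‖·‖-ball centered at x̂ minimizes the r-th moment about x̂. -/

import Mathlib

open MeasureTheory Filter Set
open scoped ENNReal Topology ProbabilityTheory Pointwise

noncomputable section

/-- `N` is a norm on `ℝ^d`. -/
structure IsNorm {d : ℕ} (N : (Fin d → ℝ) → ℝ) : Prop where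
  nonneg : ∀ x, 0 ≤ N x
  eq_zero_iff : ∀ x, N x = 0 ↔ x = 0
  smul : ∀ (c : ℝ) (x : Fin d → ℝ), N (c • x) = |c| * N x
  triangle : ∀ x y, N (x + y) ≤ N x + N y

/-- Lebesgue volume `V_d` of the unit ball of the norm `N`. -/
def unitBallVol {d : ℕ} (N : (Fin d → ℝ) → ℝ) : ℝ :=
  (volume {x : Fin d → ℝ | N x ≤ 1}).toReal

/-- A (symbol-wise) quantizer: countably many disjoint Borel quantization regions `S i`
covering the space, with reconstruction values `c i`. -/
structure Quantizer (E : Type*) [MeasurableSpace E] where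
  S : ℤ → Set E
  c : ℤ → E
  meas : ∀ i, MeasurableSet (S i)
  disj : Pairwise (Function.onFun Disjoint S)
  cover : ⋃ i, S i = Set.univ

/-- Expected `r`-th power distortion `E[‖X - q(X)‖^r]` of a quantizer, for a source with law `μ`
and norm `N`. -/
def Quantizer.distortion {E : Type*} [MeasurableSpace E] [Sub E] (q : Quantizer E)
    (μ : Measure E) (N : E → ℝ) (r : ℝ) : ℝ≥0∞ :=
  ∑' i, ∫⁻ x in q.S i, ENNReal.ofReal (N (x - q.c i) ^ r) ∂μ

/-- Output entropy `H(q(X)) = -∑ pᵢ log pᵢ` of a quantizer (as an extended nonneg. real). -/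
def Quantizer.entropy {E : Type*} [MeasurableSpace E] (q : Quantizer E) (μ : Measure E) : ℝ≥0∞ :=
  ∑' i, ENNReal.ofReal (Real.negMulLog (μ (q.S i)).toReal)

/-- Output entropy `H(q(X)) = -∑ pᵢ log pᵢ` of a quantizer (as a real number). -/
def Quantizer.entropyR {E : Type*} [MeasurableSpace E] (q : Quantizer E) (μ : Measure E) : ℝ :=
  ∑' i, Real.negMulLog (μ (q.S i)).toReal

open scoped Classical in
/-- Kullback-Leibler divergence between two measures. -/
def klDiv {α : Type*} [MeasurableSpace α] (μ ν : Measure α) : ℝ≥0∞ :=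
  if μ ≪ ν ∧ Integrable (fun x => Real.log (μ.rnDeriv ν x).toReal) μ
  then ENNReal.ofReal (∫ x, Real.log (μ.rnDeriv ν x).toReal ∂μ)
  else ⊤

/-- Mutual information of a joint law `π`, i.e. the KL divergence of `π` from the product of
its marginals. -/
def mutualInfo {α β : Type*} [MeasurableSpace α] [MeasurableSpace β]
    (π : Measure (α × β)) : ℝ≥0∞ :=
  klDiv π ((π.map Prod.fst).prod (π.map Prod.snd))

/-- The rate-distortion function `R(D)`: the infimum of the mutual information `I(X; X̂)` over
all Markov kernels `P_{X̂|X}` with expected `r`-th power distortion at most `D`. -/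
def RDfun {E : Type*} [MeasurableSpace E] [Sub E] (μ : Measure E) (N : E → ℝ) (r D : ℝ) :
    ℝ≥0∞ :=
  ⨅ (κ : ProbabilityTheory.Kernel E E) (_ : ProbabilityTheory.IsMarkovKernel κ)
    (_ : ∫⁻ p, ENNReal.ofReal (N (p.1 - p.2) ^ r) ∂(μ.compProd κ) ≤ ENNReal.ofReal D),
    mutualInfo (μ.compProd κ)

/-- The smallest output entropy `R_{r,d}(D)` of a quantizer with `r`-th power distortion
at most `D`. -/
def RQfun {E : Type*} [MeasurableSpace E] [Sub E] (μ : Measure E) (N : E → ℝ) (r D : ℝ) :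
    ℝ≥0∞ :=
  ⨅ (q : Quantizer E) (_ : q.distortion μ N r ≤ ENNReal.ofReal D), q.entropy μ

/-- The asymptotic excess rate `ℛ = liminf_{D ↓ 0} (R_{r,d}(D) - R(D))`. -/
def excessRate {E : Type*} [MeasurableSpace E] [Sub E] (μ : Measure E) (N : E → ℝ) (r : ℝ) :
    ℝ :=
  Filter.liminf (fun D => (RQfun μ N r D).toReal - (RDfun μ N r D).toReal) (𝓝[>] (0:ℝ))

/-- The upper incomplete Gamma function `Γ(s, a) = ∫_a^∞ ξ^(s-1) e^(-ξ) dξ`. -/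
def uGamma (s a : ℝ) : ℝ := ∫ ξ in Set.Ioi a, ξ ^ (s - 1) * Real.exp (-ξ)

/-- The part of the quantization cell `S i` within distance `ε` of the reconstruction point. -/
def Bcell {E : Type*} [MeasurableSpace E] [Sub E] (q : Quantizer E) (N : E → ℝ) (ε : ℝ)
    (i : ℤ) : Set E :=
  {x | x ∈ q.S i ∧ N (x - q.c i) ≤ ε}


lemma IsNorm.continuous {d : ℕ} {N : (Fin d → ℝ) → ℝ} (hN : IsNorm N) : Continuous N := by
  refine (ConvexOn.locallyLipschitz ⟨convex_univ, fun x _ y _ a b ha hb _ => ?_⟩).continuous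
  calc N (a • x + b • y) ≤ N (a • x) + N (b • y) := hN.triangle _ _
    _ = a • N x + b • N y := by
      rw [hN.smul, hN.smul, abs_of_nonneg ha, abs_of_nonneg hb, smul_eq_mul, smul_eq_mul]

lemma IsNorm.volume_sub_le {d : ℕ} {N : (Fin d → ℝ) → ℝ} (hN : IsNorm N) (a : Fin d → ℝ)
    {t : ℝ} (ht : 0 < t) :
    volume {x | N (x - a) ≤ t} = ENNReal.ofReal (t ^ d) * volume {x | N x ≤ 1} := by
  have hshift : volume {x | N (x - a) ≤ t} = volume {x | N x ≤ t} :=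
    (measurePreserving_sub_right volume a).measure_preimage
      (hN.continuous.measurable measurableSet_Iic).nullMeasurableSet
  have hscale : {x | N x ≤ t} = t • {x | N x ≤ 1} := by
    ext x
    rw [mem_smul_set_iff_inv_smul_mem₀ ht.ne', mem_ofPred_eq, mem_ofPred_eq, hN.smul,
      abs_of_pos (inv_pos.2 ht), inv_mul_le_iff₀ ht, mul_one]
  rw [hshift, hscale, Measure.addHaar_smul_of_nonneg _ ht.le, Module.finrank_fin_fun]

/-- Among sets of equal finite measure, a sublevel set of `f` minimizes the integral of `f`. -/
lemma setLIntegral_sublevel_le {α : Type*} [MeasurableSpace α] {μ : Measure α} {f : α → ℝ≥0∞}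
    {E B : Set α} (hE : MeasurableSet E) (hB : MeasurableSet B) {c : ℝ≥0∞}
    (hle : ∀ x ∈ E, f x ≤ c) (hge : ∀ x ∉ E, c ≤ f x) (hμ : μ E = μ B) (hfin : μ B ≠ ⊤) :
    ∫⁻ x in E, f x ∂μ ≤ ∫⁻ x in B, f x ∂μ := by
  have hdiff : μ (E \ B) = μ (B \ E) := by
    have h1 := measure_sdiff_add_inter (μ := μ) E hB
    have h2 := measure_sdiff_add_inter (μ := μ) B hE
    rw [inter_comm] at h2
    have h3 : μ (E ∩ B) ≠ ⊤ := measure_ne_top_of_subset inter_subset_right hfin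
    exact (ENNReal.add_left_inj h3).1 (h1.trans (hμ.trans h2.symm))
  rw [← lintegral_inter_add_sdiff f E hB, ← lintegral_inter_add_sdiff f B hE, inter_comm B E]
  refine add_le_add_right ?_ _
  calc ∫⁻ x in E \ B, f x ∂μ ≤ ∫⁻ _ in E \ B, c ∂μ :=
        setLIntegral_mono' (hE.diff hB) fun x hx => hle x hx.1
    _ = ∫⁻ _ in B \ E, c ∂μ := by rw [setLIntegral_const, setLIntegral_const, hdiff]
    _ ≤ ∫⁻ x in B \ E, f x ∂μ := setLIntegral_mono' (hB.diff hE) fun x hx => hge x hx.2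

lemma mul_integral_sub_mul_rpow {d : ℕ} {r : ℝ} (hr : 0 < r) {V ρ : ℝ} (hρ : 0 < ρ) :
    IntegrableOn (fun t : ℝ => (V * ρ ^ d - V * t ^ d) * t ^ (r - 1)) (Ioc 0 ρ) ∧
    r * ∫ t in Ioc 0 ρ, (V * ρ ^ d - V * t ^ d) * t ^ (r - 1)
      = (d / (d + r)) * (V * ρ ^ ((d : ℝ) + r)) := by
  have heq : EqOn (fun t : ℝ => (V * ρ ^ d) * t ^ (r - 1) - V * t ^ ((d : ℝ) + r - 1))
      (fun t : ℝ => (V * ρ ^ d - V * t ^ d) * t ^ (r - 1)) (Ioc 0 ρ) := fun t ht => by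
    have : t ^ ((d : ℝ) + r - 1) = t ^ d * t ^ (r - 1) := by
      rw [add_sub_assoc, Real.rpow_add ht.1, Real.rpow_natCast]
    simp only [this]
    ring
  have hd : (0 : ℝ) ≤ d := d.cast_nonneg
  have i1 : IntervalIntegrable (fun t : ℝ => (V * ρ ^ d) * t ^ (r - 1)) volume 0 ρ :=
    (intervalIntegral.intervalIntegrable_rpow' (by linarith)).const_mul _
  have i2 : IntervalIntegrable (fun t : ℝ => V * t ^ ((d : ℝ) + r - 1)) volume 0 ρ :=
    (intervalIntegral.intervalIntegrable_rpow' (by linarith)).const_mul _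
  refine ⟨((intervalIntegrable_iff_integrableOn_Ioc_of_le hρ.le).1 (i1.sub i2)).congr_fun heq
    measurableSet_Ioc, ?_⟩
  rw [← setIntegral_congr_fun measurableSet_Ioc heq, ← intervalIntegral.integral_of_le hρ.le,
    intervalIntegral.integral_sub i1 i2, intervalIntegral.integral_const_mul,
    intervalIntegral.integral_const_mul, integral_rpow (Or.inl (by linarith)),
    integral_rpow (Or.inl (by linarith)), sub_add_cancel, sub_add_cancel,
    Real.zero_rpow hr.ne', Real.zero_rpow (by positivity), Real.rpow_add hρ, Real.rpow_natCast]
  field_simp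
  ring

lemma IsNorm.ofReal_le_setLIntegral_rpow {d : ℕ} {r : ℝ} (hr : 0 < r)
    {N : (Fin d → ℝ) → ℝ} (hN : IsNorm N) (hV : 0 < unitBallVol N)
    (B : Set (Fin d → ℝ)) (a : Fin d → ℝ) {ρ : ℝ} (hρ : 0 < ρ)
    (hB : volume B = ENNReal.ofReal (unitBallVol N * ρ ^ d)) :
    ENNReal.ofReal ((d / (d + r)) * (unitBallVol N * ρ ^ ((d : ℝ) + r)))
      ≤ ∫⁻ x in B, ENNReal.ofReal (N (x - a) ^ r) := by
  set V := unitBallVol N with hVdef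
  have hvol : volume {x : Fin d → ℝ | N x ≤ 1} = ENNReal.ofReal V :=
    (ENNReal.ofReal_toReal (ENNReal.toReal_pos_iff.1 hV).2.ne).symm
  have hcont : Continuous fun x => N (x - a) := hN.continuous.comp (by fun_prop)
  obtain ⟨hint, hval⟩ := mul_integral_sub_mul_rpow (d := d) (V := V) hr hρ
  rw [lintegral_rpow_eq_lintegral_meas_lt_mul _ (ae_of_all _ fun x => hN.nonneg _)
    hcont.aemeasurable hr, ← hval, ENNReal.ofReal_mul hr.le]
  gcongr
  rw [ofReal_integral_eq_lintegral_ofReal hint]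
  · refine (setLIntegral_mono' measurableSet_Ioc fun t ht => ?_).trans
      (lintegral_mono_set Ioc_subset_Ioi_self)
    rw [ENNReal.ofReal_mul' (Real.rpow_nonneg ht.1.le _)]
    gcongr
    rw [ENNReal.ofReal_sub _ (by have := ht.1; positivity), ← hB, mul_comm V,
      ENNReal.ofReal_mul (by have := ht.1; positivity), ← hvol, ← hN.volume_sub_le a ht.1,
      Measure.restrict_apply (measurableSet_lt measurable_const hcont.measurable)]
    exact le_measure_sdiff.trans (measure_mono fun x hx => ⟨by simpa using hx.2, hx.1⟩)
  · refine (ae_restrict_iff' measurableSet_Ioc).2 (ae_of_all _ fun t ht => ?_)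
    have : t ^ d ≤ ρ ^ d := pow_le_pow_left₀ ht.1.le ht.2 d
    exact mul_nonneg (by nlinarith) (Real.rpow_nonneg ht.1.le _)

/-- Eq. (80): among Borel sets of a given Lebesgue measure, the ball
minimizes the `r`-th moment:
`∫_B ‖x - x̂‖^r dx ≥ (d/(d+r)) Λ^{1+r/d} / V_d^{r/d}`, and any ball centered at `x̂` with the
same measure as `B` has a smaller moment. -/
theorem ball_minimizes_rth_moment {d : ℕ} (hd : 0 < d) {r : ℝ} (hr : 0 < r)
    {N : (Fin d → ℝ) → ℝ} (hN : IsNorm N)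
    (B : Set (Fin d → ℝ)) (hB : MeasurableSet B) (hBfin : volume B < ⊤)
    (xhat : Fin d → ℝ) :
    (ENNReal.ofReal (((d : ℝ) / ((d : ℝ) + r)) * (volume B).toReal ^ (1 + r / (d : ℝ))
          / unitBallVol N ^ (r / (d : ℝ)))
        ≤ ∫⁻ x in B, ENNReal.ofReal (N (x - xhat) ^ r))
    ∧ ∀ ρ : ℝ, 0 ≤ ρ → volume {x | N (x - xhat) ≤ ρ} = volume B →
        ∫⁻ x in {x | N (x - xhat) ≤ ρ}, ENNReal.ofReal (N (x - xhat) ^ r)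
          ≤ ∫⁻ x in B, ENNReal.ofReal (N (x - xhat) ^ r) := by
  refine ⟨?_, fun ρ hρ hvol => ?_⟩
  · rcases (ENNReal.toReal_nonneg (a := volume {x | N x ≤ 1})).eq_or_lt with hV | hV
    · rw [unitBallVol, ← hV, Real.zero_rpow (by positivity), div_zero, ENNReal.ofReal_zero]
      exact zero_le
    rcases (ENNReal.toReal_nonneg (a := volume B)).eq_or_lt with hΛ | hΛ
    · rw [← hΛ, Real.zero_rpow (by positivity), mul_zero, zero_div, ENNReal.ofReal_zero]
      exact zero_le
    change 0 < unitBallVol N at hV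
    set V := unitBallVol N
    set Λ := (volume B).toReal with hΛdef
    have hd' : (0 : ℝ) < d := Nat.cast_pos.2 hd
    have hq : 0 < Λ / V := div_pos hΛ hV
    have hpow : ((Λ / V) ^ (1 / (d : ℝ))) ^ d = Λ / V := by
      rw [one_div, Real.rpow_inv_natCast_pow hq.le hd.ne']
    convert hN.ofReal_le_setLIntegral_rpow hr hV B xhat (Real.rpow_pos_of_pos hq (1 / (d : ℝ)))
      (by rw [hpow, mul_div_cancel₀ _ hV.ne', ENNReal.ofReal_toReal hBfin.ne]) using 2
    rw [mul_div_assoc, ← Real.rpow_mul hq.le,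
      show 1 / (d : ℝ) * (d + r) = 1 + r / d by field_simp,
      Real.div_rpow hΛ.le hV.le, Real.rpow_add hV, Real.rpow_one]
    congr 1
    have : 0 < V ^ (r / (d : ℝ)) := Real.rpow_pos_of_pos hV _
    field_simp
    rfl
  · have hcont : Continuous fun x => N (x - xhat) := hN.continuous.comp (by fun_prop)
    refine setLIntegral_sublevel_le (c := ENNReal.ofReal (ρ ^ r))
      (measurableSet_le hcont.measurable measurable_const) hB (fun x hx => ?_) (fun x hx => ?_)
      hvol hBfin.ne
    · exact ENNReal.ofReal_le_ofReal (Real.rpow_le_rpow (hN.nonneg _) hx hr.le)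
    · exact ENNReal.ofReal_le_ofReal (Real.rpow_le_rpow hρ (not_le.1 hx).le hr.le)

end
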